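/- arXiv:2504.21261 — 2 statements merged into one kernel-verified Lean document; each statement's English description precedes it below -/
import Mathlib

section
/- Let X, E : Ω → ℝ be measurable with X and E independent under every P^e. Let f : ℝ → ℝ → ℝ be jointly measurable such that each f x is a C¹ diffeomorphism of ℝ, and set Y := (ω ↦ f (X ω) (E ω)). Suppose for each e that (P^e).map E = volume.withDensity p^e for a measurable density p^e : ℝ → ℝ≥0, with the positivity condition ∑_e p^e(t) > 0 for every t ∈ ℝ. Define the conditional densities q^e(x, y) := p^e((f x)⁻¹(y)) · |deriv (f x)⁻¹ (y)| and define Γ : Ω → ℝ^m by Γ(ω)_e := q^e(X ω, Y ω) / ∑_{e'} q^{e'}(X ω, Y ω). Then for every e, the random variables Γ and X are independent under P^e. -/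
open MeasureTheory ProbabilityTheory
open scoped ENNReal NNReal

/-- A C¹ diffeomorphism of `ℝ`: a bijection that is continuously differentiable
with continuously differentiable inverse. -/
def IsC1Diffeo (g : ℝ → ℝ) : Prop :=
  Function.Bijective g ∧ ContDiff ℝ 1 g ∧ ContDiff ℝ 1 (Function.invFun g)

/-- The derivative of the inverse of a C¹ diffeomorphism of `ℝ` vanishes nowhere on its range. -/
theorem IsC1Diffeo.deriv_invFun_ne_zero {g : ℝ → ℝ} (hg : IsC1Diffeo g) (t : ℝ) :
    deriv (Function.invFun g) (g t) ≠ 0 := by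
  obtain ⟨hbij, hg1, hinv⟩ := hg
  have hcomp : HasDerivAt (Function.invFun g ∘ g)
      (deriv (Function.invFun g) (g t) * deriv g t) t :=
    ((hinv.differentiable one_ne_zero).differentiableAt.hasDerivAt).comp t
      (hg1.differentiable one_ne_zero).differentiableAt.hasDerivAt
  rw [Function.invFun_comp hbij.injective] at hcomp
  exact left_ne_zero_of_mul_eq_one (hcomp.unique (hasDerivAt_id t))

/-- Main theorem (positive form), bivariate case: in the model `Y = f (X, E)` with
`X ⫫ E` in every domain, each fixed-cause functional `f x` a C¹ diffeomorphism of `ℝ`,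
and the noise having Lebesgue densities `p e` with `∑ₑ p e t > 0` everywhere, the
statistic `Γ(ω)ₑ = qᵉ(Xω, Yω) / ∑ₑ' qᵉ'(Xω, Yω)` — where
`qᵉ(x, y) = pᵉ((f x)⁻¹ y) · |deriv (f x)⁻¹ y|` — is independent of `X`
in every domain. -/
theorem gamma_indep_of_bgm {Ω : Type*} [MeasurableSpace Ω]
    (m : ℕ) (hm : 1 ≤ m)
    (P : Fin m → Measure Ω) (hP : ∀ e, IsProbabilityMeasure (P e))
    (X E : Ω → ℝ) (hX : Measurable X) (hE : Measurable E)
    (hindep : ∀ e : Fin m, IndepFun X E (P e))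
    (f : ℝ → ℝ → ℝ) (hf : Measurable (Function.uncurry f))
    (hdiff : ∀ x, IsC1Diffeo (f x))
    (Y : Ω → ℝ) (hY : Y = fun ω => f (X ω) (E ω))
    (p : Fin m → ℝ → ℝ≥0) (hp : ∀ e, Measurable (p e))
    (hd : ∀ e, (P e).map E = volume.withDensity (fun t => (p e t : ℝ≥0∞)))
    (hpos : ∀ t : ℝ, 0 < ∑ e : Fin m, (p e t : ℝ))
    (q : Fin m → ℝ → ℝ → ℝ)
    (hq : ∀ (e : Fin m) (x y : ℝ),
      q e x y = (p e (Function.invFun (f x) y) : ℝ) * |deriv (Function.invFun (f x)) y|)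
    (Γ : Ω → Fin m → ℝ)
    (hΓ : Γ = fun ω => fun e => q e (X ω) (Y ω) / ∑ e' : Fin m, q e' (X ω) (Y ω)) :
    ∀ e : Fin m, IndepFun Γ X (P e) := by
  have hΓE : Γ = (fun t e => (p e t : ℝ) / ∑ e' : Fin m, (p e' t : ℝ)) ∘ E := by
    funext ω e
    have hinv : Function.invFun (f (X ω)) (f (X ω) (E ω)) = E ω :=
      Function.leftInverse_invFun (hdiff (X ω)).1.injective (E ω)
    have hne := abs_ne_zero.mpr ((hdiff (X ω)).deriv_invFun_ne_zero (E ω))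
    simp only [hΓ, hY, hq, hinv, ← Finset.sum_mul, Function.comp_apply]
    exact mul_div_mul_right _ _ hne
  have hmeas : Measurable fun (t : ℝ) (e : Fin m) => (p e t : ℝ) / ∑ e' : Fin m, (p e' t : ℝ) := by
    fun_prop
  intro e
  rw [hΓE]
  exact (hindep e).symm.comp hmeas measurable_id
end

section
/- Let 𝒳 be a measurable space, let ℰ and 𝒴 be countable types (with the discrete measurable structure), let X : Ω → 𝒳 and E : Ω → ℰ be measurable and independent under every P^e, let f : 𝒳 → ℰ → 𝒴 be such that each f x : ℰ → 𝒴 is bijective, and set Y := (ω ↦ f (X ω) (E ω)). Define Γ : Ω → ℝ^m by Γ(ω)_e := P^e(E = (f (X ω))⁻¹(Y ω)) / ∑_{e'} P^{e'}(E = (f (X ω))⁻¹(Y ω)) when the denominator is positive, and Γ(ω) := 0 otherwise. Then for every e, the random variables Γ and X are independent under P^e. -/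
open MeasureTheory ProbabilityTheory
open scoped ENNReal NNReal

/-- The discrete density-vectorization built from the point masses of `E`:
at the point `t`, its `e`-th entry is `Pᵉ(E = t) / ∑ₑ' Pᵉ'(E = t)` when the sum is
positive, and it is `0` otherwise. -/
noncomputable def discVec {Ω α : Type*} [MeasurableSpace Ω] {m : ℕ}
    (P : Fin m → Measure Ω) (E : Ω → α) (t : α) : Fin m → ℝ :=
  if 0 < ∑ e' : Fin m, ((P e') {ω | E ω = t}).toReal then
    fun e => ((P e) {ω | E ω = t}).toReal / ∑ e' : Fin m, ((P e') {ω | E ω = t}).toReal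
  else 0

/-- Discrete form of the main theorem: in the model `Y = f (X, E)` with discrete
exogenous noise `E`, `X ⫫ E` in every domain, and each fixed-cause functional
`f x : ℰ → 𝒴` bijective, the statistic
`Γ(ω)ₑ = Pᵉ(E = (f (X ω))⁻¹ (Y ω)) / ∑ₑ' Pᵉ'(E = (f (X ω))⁻¹ (Y ω))`
(set to `0` when the denominator vanishes) is independent of `X` in every domain. -/
theorem discrete_gamma_indep_of_bgm {Ω : Type*} [MeasurableSpace Ω]
    (m : ℕ) (hm : 1 ≤ m)
    (P : Fin m → Measure Ω) (hP : ∀ e, IsProbabilityMeasure (P e))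
    {𝒳 : Type*} [MeasurableSpace 𝒳]
    {ℰ 𝒴 : Type*} [Countable ℰ] [Countable 𝒴] [Nonempty ℰ]
    [MeasurableSpace ℰ] [DiscreteMeasurableSpace ℰ]
    [MeasurableSpace 𝒴] [DiscreteMeasurableSpace 𝒴]
    (X : Ω → 𝒳) (E : Ω → ℰ) (hX : Measurable X) (hE : Measurable E)
    (hindep : ∀ e : Fin m, IndepFun X E (P e))
    (f : 𝒳 → ℰ → 𝒴) (hf : ∀ x, Function.Bijective (f x))
    (Y : Ω → 𝒴) (hY : Y = fun ω => f (X ω) (E ω))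
    (Γ : Ω → Fin m → ℝ)
    (hΓ : Γ = fun ω => discVec P E (Function.invFun (f (X ω)) (Y ω))) :
    ∀ e : Fin m, IndepFun Γ X (P e) := by
  intro e
  have hΓE : Γ = discVec P E ∘ E := by
    subst hΓ hY
    funext ω
    exact congrArg (discVec P E) (Function.leftInverse_invFun (hf (X ω)).injective (E ω))
  rw [hΓE]
  exact (hindep e).symm.comp (Measurable.of_discrete : Measurable (discVec P E)) measurable_id
end
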